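/- arXiv:1904.11891 — 16 statements merged into one kernel-verified Lean document; each statement's English description precedes it below -/
import Mathlib

section
/- Let σ ∈ ℂ be such that σE − A and σÊ − Â are both invertible, and suppose the vector Φ(σ)B lies in the range of V. Then V Φ̂(σ) B̂ = Φ(σ) B. -/
open Matrix

/-- If `Φ(σ)B` lies in the range of `V`, then `V Φ̂(σ) B̂ = Φ(σ) B`. -/
theorem stmt_0 {n r : ℕ}
    (E A : Matrix (Fin n) (Fin n) ℂ) (B C : Fin n → ℂ)
    (V W : Matrix (Fin n) (Fin r) ℂ) (σ : ℂ)
    (hfull : IsUnit (σ • E - A))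
    (hred : IsUnit (σ • (Wᵀ * E * V) - Wᵀ * A * V))
    (hV : ∃ z : Fin r → ℂ, (σ • E - A)⁻¹ *ᵥ B = V *ᵥ z) :
    V *ᵥ ((σ • (Wᵀ * E * V) - Wᵀ * A * V)⁻¹ *ᵥ (Wᵀ *ᵥ B))
      = (σ • E - A)⁻¹ *ᵥ B := by
  obtain ⟨z, hz⟩ := hV
  have hB : B = (σ • E - A) *ᵥ (V *ᵥ z) := by
    rw [← hz, Matrix.mulVec_mulVec,
      Matrix.mul_nonsing_inv _ ((Matrix.isUnit_iff_isUnit_det _).1 hfull), Matrix.one_mulVec]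
  have hM : σ • (Wᵀ * E * V) - Wᵀ * A * V = Wᵀ * (σ • E - A) * V := by
    rw [Matrix.mul_sub, Matrix.sub_mul, Matrix.mul_smul, Matrix.smul_mul]
  have hWB : Wᵀ *ᵥ B = (σ • (Wᵀ * E * V) - Wᵀ * A * V) *ᵥ z := by
    rw [hM, hB, Matrix.mulVec_mulVec, Matrix.mulVec_mulVec, Matrix.mul_assoc]
  rw [hz, hWB, Matrix.mulVec_mulVec z,
    Matrix.nonsing_inv_mul _ ((Matrix.isUnit_iff_isUnit_det _).1 hred), Matrix.one_mulVec]
end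

section
/- Let μ ∈ ℂ be such that μE − A and μÊ − Â are both invertible, and suppose the vector Φ(μ)ᵀC lies in the range of W. Then W Φ̂(μ)ᵀ Ĉ = Φ(μ)ᵀ C. -/
open Matrix

/-- If `Φ(μ)ᵀC` lies in the range of `W`, then `W Φ̂(μ)ᵀ Ĉ = Φ(μ)ᵀ C`. -/
theorem stmt_1 {n r : ℕ}
    (E A : Matrix (Fin n) (Fin n) ℂ) (B C : Fin n → ℂ)
    (V W : Matrix (Fin n) (Fin r) ℂ) (μ : ℂ)
    (hfull : IsUnit (μ • E - A))
    (hred : IsUnit (μ • (Wᵀ * E * V) - Wᵀ * A * V))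
    (hW : ∃ z : Fin r → ℂ, ((μ • E - A)⁻¹)ᵀ *ᵥ C = W *ᵥ z) :
    W *ᵥ (((μ • (Wᵀ * E * V) - Wᵀ * A * V)⁻¹)ᵀ *ᵥ (Vᵀ *ᵥ C))
      = ((μ • E - A)⁻¹)ᵀ *ᵥ C := by
  obtain ⟨z, hz⟩ := hW
  have hK : μ • (Wᵀ * E * V) - Wᵀ * A * V = Wᵀ * (μ • E - A) * V := by
    simp [Matrix.mul_sub, Matrix.sub_mul]
  rw [hK] at hred ⊢
  generalize μ • E - A = K at *
  have hC : C = Kᵀ *ᵥ (W *ᵥ z) := by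
    rw [← hz, Matrix.mulVec_mulVec, ← Matrix.transpose_mul,
      Matrix.nonsing_inv_mul _ ((Matrix.isUnit_iff_isUnit_det _).1 hfull)]
    simp
  have hVC : Vᵀ *ᵥ C = (Wᵀ * K * V)ᵀ *ᵥ z := by
    rw [hC]
    simp [Matrix.mulVec_mulVec, Matrix.transpose_mul, Matrix.mul_assoc]
  rw [hz, hVC, Matrix.mulVec_mulVec _ _ (Wᵀ * K * V)ᵀ, ← Matrix.transpose_mul,
    Matrix.mul_nonsing_inv _ ((Matrix.isUnit_iff_isUnit_det _).1 hred)]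
  simp
end

section
/- Let σ ∈ ℂ be such that σE − A and σÊ − Â are both invertible, and suppose Φ(σ)B lies in the range of V. Then the linear transfer functions of the original and the reduced system interpolate at σ: F_L(σ) = F̂_L(σ). -/
open Matrix

/-- If `Φ(σ)B` lies in the range of `V`, then `F_L(σ) = F̂_L(σ)`. -/
theorem stmt_2 {n r : ℕ}
    (E A : Matrix (Fin n) (Fin n) ℂ) (B C : Fin n → ℂ)
    (V W : Matrix (Fin n) (Fin r) ℂ) (σ : ℂ)
    (hfull : IsUnit (σ • E - A))
    (hred : IsUnit (σ • (Wᵀ * E * V) - Wᵀ * A * V))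
    (hV : ∃ z : Fin r → ℂ, (σ • E - A)⁻¹ *ᵥ B = V *ᵥ z) :
    C ⬝ᵥ ((σ • E - A)⁻¹ *ᵥ B)
      = (Vᵀ *ᵥ C) ⬝ᵥ ((σ • (Wᵀ * E * V) - Wᵀ * A * V)⁻¹ *ᵥ (Wᵀ *ᵥ B)) := by
  obtain ⟨z, hz⟩ := hV
  have hd := (Matrix.isUnit_iff_isUnit_det _).mp hfull
  have hd' := (Matrix.isUnit_iff_isUnit_det _).mp hred
  have hB : B = (σ • E - A) *ᵥ (V *ᵥ z) := by
    rw [← hz, Matrix.mulVec_mulVec, Matrix.mul_nonsing_inv _ hd, Matrix.one_mulVec]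
  have hM : σ • (Wᵀ * E * V) - Wᵀ * A * V = Wᵀ * (σ • E - A) * V := by
    simp [Matrix.mul_sub, Matrix.sub_mul]
  have hWB : Wᵀ *ᵥ B = (σ • (Wᵀ * E * V) - Wᵀ * A * V) *ᵥ z := by
    rw [hM, hB, Matrix.mulVec_mulVec, Matrix.mulVec_mulVec, Matrix.mul_assoc]
  rw [hz, hWB, Matrix.mulVec_mulVec, Matrix.nonsing_inv_mul _ hd', Matrix.one_mulVec,
    Matrix.dotProduct_mulVec, Matrix.mulVec_transpose]
end

section
/- Let μ ∈ ℂ be such that μE − A and μÊ − Â are both invertible, and suppose Φ(μ)ᵀC lies in the range of W. Then the linear transfer functions of the original and the reduced system interpolate at μ: F_L(μ) = F̂_L(μ). -/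
open Matrix

/-- If `Φ(μ)ᵀC` lies in the range of `W`, then `F_L(μ) = F̂_L(μ)`. -/
theorem stmt_3 {n r : ℕ}
    (E A : Matrix (Fin n) (Fin n) ℂ) (B C : Fin n → ℂ)
    (V W : Matrix (Fin n) (Fin r) ℂ) (μ : ℂ)
    (hfull : IsUnit (μ • E - A))
    (hred : IsUnit (μ • (Wᵀ * E * V) - Wᵀ * A * V))
    (hW : ∃ z : Fin r → ℂ, ((μ • E - A)⁻¹)ᵀ *ᵥ C = W *ᵥ z) :
    C ⬝ᵥ ((μ • E - A)⁻¹ *ᵥ B)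
      = (Vᵀ *ᵥ C) ⬝ᵥ ((μ • (Wᵀ * E * V) - Wᵀ * A * V)⁻¹ *ᵥ (Wᵀ *ᵥ B)) := by
  obtain ⟨z, hz⟩ := hW
  have hN : μ • (Wᵀ * E * V) - Wᵀ * A * V = Wᵀ * (μ • E - A) * V := by
    simp [Matrix.mul_sub, Matrix.sub_mul]
  rw [hN] at hred ⊢
  generalize μ • E - A = M at *
  have hM := (Matrix.isUnit_iff_isUnit_det _).1 hfull
  have hN' := (Matrix.isUnit_iff_isUnit_det _).1 hred
  have hC : C = Mᵀ *ᵥ (W *ᵥ z) := by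
    rw [← hz, Matrix.mulVec_mulVec, ← Matrix.transpose_mul, Matrix.nonsing_inv_mul _ hM,
      Matrix.transpose_one, Matrix.one_mulVec]
  have hVC : Vᵀ *ᵥ C = (Wᵀ * M * V)ᵀ *ᵥ z := by
    rw [hC]
    simp only [Matrix.mulVec_mulVec, Matrix.transpose_mul, Matrix.transpose_transpose,
      Matrix.mul_assoc]
  rw [hVC, Matrix.mulVec_transpose, ← Matrix.dotProduct_mulVec, Matrix.mulVec_mulVec,
    Matrix.mul_nonsing_inv _ hN', Matrix.one_mulVec, Matrix.dotProduct_mulVec,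
    Matrix.dotProduct_mulVec, Matrix.vecMul_transpose, ← hz, Matrix.mulVec_transpose]
end

section
/- Let σ ∈ ℂ be such that σE − A and σÊ − Â are both invertible, and suppose Φ(σ)B lies in the range of V and Φ(σ)ᵀC lies in the range of W. Then the derivatives of the transfer functions coincide at σ: the derivative of s ↦ F_L(s) at σ equals the derivative of s ↦ F̂_L(s) at σ (both functions being differentiable at σ, since invertibility holds on a neighborhood of σ). -/
open Matrix

attribute [local instance] Matrix.linftyOpNormedRing Matrix.linftyOpNormedAlgebra in
theorem hasDerivAt_transfer {m : ℕ} (E A : Matrix (Fin m) (Fin m) ℂ) (B C : Fin m → ℂ) (σ : ℂ)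
    (h : IsUnit (σ • E - A)) :
    HasDerivAt (fun s : ℂ => C ⬝ᵥ ((s • E - A)⁻¹ *ᵥ B))
      (-(((σ • E - A)⁻¹ᵀ *ᵥ C) ⬝ᵥ (E *ᵥ ((σ • E - A)⁻¹ *ᵥ B)))) σ := by
  have h1 : HasDerivAt (fun s : ℂ => s • E - A) E σ := by
    have h0 := ((hasDerivAt_id σ).smul_const E).sub_const A
    rw [one_smul] at h0
    exact h0
  obtain ⟨u, hu⟩ := h
  have h2 := hasFDerivAt_ringInverse (𝕜 := ℂ) u
  rw [hu] at h2
  have h3 := h2.comp_hasDerivAt σ h1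
  let L : Matrix (Fin m) (Fin m) ℂ →ₗ[ℂ] ℂ :=
    { toFun := fun M => C ⬝ᵥ (M *ᵥ B)
      map_add' := fun M N => by simp [Matrix.add_mulVec, dotProduct_add]
      map_smul' := fun c M => by simp [Matrix.smul_mulVec, dotProduct_smul] }
  have h4 := (LinearMap.toContinuousLinearMap L).hasFDerivAt.comp_hasDerivAt σ h3
  have hui : ((u⁻¹ : (Matrix (Fin m) (Fin m) ℂ)ˣ) : Matrix (Fin m) (Fin m) ℂ)
      = (σ • E - A)⁻¹ := by
    rw [← hu, Matrix.coe_units_inv]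
  have f1 : (fun s : ℂ => C ⬝ᵥ ((s • E - A)⁻¹ *ᵥ B)) =
      (LinearMap.toContinuousLinearMap L) ∘ Ring.inverse ∘ fun s => s • E - A := by
    funext s
    simp [L, Matrix.nonsing_inv_eq_ringInverse]
  have f2 : -(((σ • E - A)⁻¹ᵀ *ᵥ C) ⬝ᵥ (E *ᵥ ((σ • E - A)⁻¹ *ᵥ B))) =
      (LinearMap.toContinuousLinearMap L)
      ((-((ContinuousLinearMap.mulLeftRight ℂ (Matrix (Fin m) (Fin m) ℂ)) ↑u⁻¹) ↑u⁻¹) E) := by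
    simp [L, hui, Matrix.vecMul_neg, Matrix.mulVec_transpose, Matrix.dotProduct_mulVec,
      Matrix.vecMul_vecMul, Matrix.mul_assoc]
  rw [f1, f2]
  exact h4

/-- Hermite interpolation: if `Φ(σ)B ∈ range V` and `Φ(σ)ᵀC ∈ range W`, then the
derivatives of the transfer functions `F_L` and `F̂_L` agree at `σ` (both being
differentiable there). -/
theorem stmt_4 {n r : ℕ}
    (E A : Matrix (Fin n) (Fin n) ℂ) (B C : Fin n → ℂ)
    (V W : Matrix (Fin n) (Fin r) ℂ) (σ : ℂ)
    (hfull : IsUnit (σ • E - A))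
    (hred : IsUnit (σ • (Wᵀ * E * V) - Wᵀ * A * V))
    (hV : ∃ z : Fin r → ℂ, (σ • E - A)⁻¹ *ᵥ B = V *ᵥ z)
    (hW : ∃ z : Fin r → ℂ, ((σ • E - A)⁻¹)ᵀ *ᵥ C = W *ᵥ z) :
    DifferentiableAt ℂ (fun s : ℂ => C ⬝ᵥ ((s • E - A)⁻¹ *ᵥ B)) σ ∧
    DifferentiableAt ℂ
      (fun s : ℂ => (Vᵀ *ᵥ C) ⬝ᵥ ((s • (Wᵀ * E * V) - Wᵀ * A * V)⁻¹ *ᵥ (Wᵀ *ᵥ B))) σ ∧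
    deriv (fun s : ℂ => C ⬝ᵥ ((s • E - A)⁻¹ *ᵥ B)) σ
      = deriv (fun s : ℂ =>
          (Vᵀ *ᵥ C) ⬝ᵥ ((s • (Wᵀ * E * V) - Wᵀ * A * V)⁻¹ *ᵥ (Wᵀ *ᵥ B))) σ := by
  have hf := hasDerivAt_transfer E A B C σ hfull
  have hr := hasDerivAt_transfer (Wᵀ * E * V) (Wᵀ * A * V) (Wᵀ *ᵥ B) (Vᵀ *ᵥ C) σ hred
  refine ⟨hf.differentiableAt, hr.differentiableAt, ?_⟩
  rw [hf.deriv, hr.deriv]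
  obtain ⟨z, hz⟩ := hV
  obtain ⟨y, hy⟩ := hW
  have hM : σ • (Wᵀ * E * V) - Wᵀ * A * V = Wᵀ * (σ • E - A) * V := by
    simp [Matrix.mul_sub, Matrix.sub_mul]
  rw [hM] at hred ⊢
  rw [hz, hy]
  generalize σ • E - A = M at *
  have hd := (Matrix.isUnit_iff_isUnit_det _).1 hfull
  have hdr := (Matrix.isUnit_iff_isUnit_det _).1 hred
  have hB : B = M *ᵥ (V *ᵥ z) := by
    rw [← hz, Matrix.mulVec_mulVec, Matrix.mul_nonsing_inv _ hd, Matrix.one_mulVec]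
  have hC : C = Mᵀ *ᵥ (W *ᵥ y) := by
    rw [← hy, Matrix.mulVec_mulVec, ← Matrix.transpose_mul, Matrix.nonsing_inv_mul _ hd,
      Matrix.transpose_one, Matrix.one_mulVec]
  have e1 : (Wᵀ * M * V)⁻¹ *ᵥ (Wᵀ *ᵥ B) = z := by
    have : Wᵀ *ᵥ B = (Wᵀ * M * V) *ᵥ z := by
      rw [hB]; simp only [Matrix.mulVec_mulVec, Matrix.mul_assoc]
    rw [this, Matrix.mulVec_mulVec, Matrix.nonsing_inv_mul _ hdr, Matrix.one_mulVec]
  have e2 : (Wᵀ * M * V)⁻¹ᵀ *ᵥ (Vᵀ *ᵥ C) = y := by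
    have : Vᵀ *ᵥ C = (Wᵀ * M * V)ᵀ *ᵥ y := by
      rw [hC]; simp only [Matrix.mulVec_mulVec, Matrix.mul_assoc, Matrix.transpose_mul,
        Matrix.transpose_transpose]
    rw [this, Matrix.mulVec_mulVec, ← Matrix.transpose_mul, Matrix.mul_nonsing_inv _ hdr,
      Matrix.transpose_one, Matrix.one_mulVec]
  rw [e1, e2]
  congr 1
  rw [← Matrix.vecMul_transpose, ← Matrix.dotProduct_mulVec]
  simp only [Matrix.mulVec_mulVec, Matrix.mul_assoc]
end

section
/- Let σ₁, σ₂ ∈ ℂ be such that σᵢE − A and σᵢÊ − Â are invertible for i = 1, 2. Suppose both Φ(σ₁)B and Φ(σ₂)NΦ(σ₁)B lie in the range of V. Then the bilinear transfer functions interpolate: F_N(σ₁, σ₂) = F̂_N(σ₁, σ₂). -/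
open Matrix

lemma reduced_solve {n r : ℕ} (E A : Matrix (Fin n) (Fin n) ℂ)
    (V W : Matrix (Fin n) (Fin r) ℂ) (σ : ℂ) (b : Fin n → ℂ) (z : Fin r → ℂ)
    (hfull : IsUnit (σ • E - A))
    (hred : IsUnit (σ • (Wᵀ * E * V) - Wᵀ * A * V))
    (h : (σ • E - A)⁻¹ *ᵥ b = V *ᵥ z) :
    (σ • (Wᵀ * E * V) - Wᵀ * A * V)⁻¹ *ᵥ (Wᵀ *ᵥ b) = z := by
  have hb : b = (σ • E - A) *ᵥ (V *ᵥ z) := by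
    rw [← h, mulVec_mulVec, mul_nonsing_inv _ ((isUnit_iff_isUnit_det _).1 hfull), one_mulVec]
  have hK : σ • (Wᵀ * E * V) - Wᵀ * A * V = Wᵀ * (σ • E - A) * V := by
    simp [Matrix.mul_sub, Matrix.sub_mul]
  have hz : Wᵀ *ᵥ b = (σ • (Wᵀ * E * V) - Wᵀ * A * V) *ᵥ z := by
    rw [hK, hb, mulVec_mulVec, mulVec_mulVec, Matrix.mul_assoc]
  rw [hz, mulVec_mulVec, nonsing_inv_mul _ ((isUnit_iff_isUnit_det _).1 hred), one_mulVec]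

/-- If `Φ(σ₁)B` and `Φ(σ₂)NΦ(σ₁)B` lie in the range of `V`, then the bilinear
transfer functions interpolate: `F_N(σ₁, σ₂) = F̂_N(σ₁, σ₂)`. -/
theorem stmt_5 {n r : ℕ}
    (E A N : Matrix (Fin n) (Fin n) ℂ) (B C : Fin n → ℂ)
    (V W : Matrix (Fin n) (Fin r) ℂ) (σ₁ σ₂ : ℂ)
    (hfull1 : IsUnit (σ₁ • E - A)) (hfull2 : IsUnit (σ₂ • E - A))
    (hred1 : IsUnit (σ₁ • (Wᵀ * E * V) - Wᵀ * A * V))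
    (hred2 : IsUnit (σ₂ • (Wᵀ * E * V) - Wᵀ * A * V))
    (hV1 : ∃ z : Fin r → ℂ, (σ₁ • E - A)⁻¹ *ᵥ B = V *ᵥ z)
    (hV2 : ∃ z : Fin r → ℂ,
      (σ₂ • E - A)⁻¹ *ᵥ (N *ᵥ ((σ₁ • E - A)⁻¹ *ᵥ B)) = V *ᵥ z) :
    C ⬝ᵥ ((σ₂ • E - A)⁻¹ *ᵥ (N *ᵥ ((σ₁ • E - A)⁻¹ *ᵥ B)))
      = (Vᵀ *ᵥ C) ⬝ᵥ ((σ₂ • (Wᵀ * E * V) - Wᵀ * A * V)⁻¹ *ᵥ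
          ((Wᵀ * N * V) *ᵥ ((σ₁ • (Wᵀ * E * V) - Wᵀ * A * V)⁻¹ *ᵥ (Wᵀ *ᵥ B)))) := by
  obtain ⟨z, hz⟩ := hV1
  obtain ⟨y, hy⟩ := hV2
  have h1 := reduced_solve E A V W σ₁ B z hfull1 hred1 hz
  have h2 := reduced_solve E A V W σ₂ _ y hfull2 hred2 hy
  have h3 : (Wᵀ * N * V) *ᵥ z = Wᵀ *ᵥ (N *ᵥ ((σ₁ • E - A)⁻¹ *ᵥ B)) := by
    rw [hz, mulVec_mulVec, mulVec_mulVec, Matrix.mul_assoc]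
  rw [h1, h3, h2, hy, dotProduct_mulVec, mulVec_transpose]
end

section
/- Let σ₁, β ∈ ℂ be such that σ₁E − A, βE − A, σ₁Ê − Â and βÊ − Â are invertible. Suppose both Φ(β)ᵀC and Φ(σ₁)ᵀ Nᵀ Φ(β)ᵀC lie in the range of W. Then the bilinear transfer functions interpolate: F_N(σ₁, β) = F̂_N(σ₁, β). -/
open Matrix

theorem aux_tr {m k : ℕ} (M : Matrix (Fin m) (Fin k) ℂ) (x : Fin m → ℂ) (y : Fin k → ℂ) :
    x ⬝ᵥ (M *ᵥ y) = (Mᵀ *ᵥ x) ⬝ᵥ y := by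
  rw [dotProduct_mulVec, mulVec_transpose]

theorem aux_red {n r : ℕ} (E A : Matrix (Fin n) (Fin n) ℂ)
    (V W : Matrix (Fin n) (Fin r) ℂ) (s : ℂ)
    (hK : IsUnit (s • E - A)) (hR : IsUnit (s • (Wᵀ * E * V) - Wᵀ * A * V))
    (c : Fin n → ℂ) (z : Fin r → ℂ) (h : ((s • E - A)⁻¹)ᵀ *ᵥ c = W *ᵥ z) (x : Fin r → ℂ) :
    (Vᵀ *ᵥ c) ⬝ᵥ ((s • (Wᵀ * E * V) - Wᵀ * A * V)⁻¹ *ᵥ x) = z ⬝ᵥ x := by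
  have e : s • (Wᵀ * E * V) - Wᵀ * A * V = Wᵀ * (s • E - A) * V := by
    simp [Matrix.mul_sub, Matrix.sub_mul]
  rw [e] at hR ⊢
  generalize s • E - A = K at *
  have hc : c = Kᵀ *ᵥ (W *ᵥ z) := by
    rw [← h, mulVec_mulVec, ← transpose_mul,
      nonsing_inv_mul _ ((isUnit_iff_isUnit_det _).1 hK), transpose_one, one_mulVec]
  have hv : Vᵀ *ᵥ c = (Wᵀ * K * V)ᵀ *ᵥ z := by
    rw [hc]; simp [transpose_mul, mulVec_mulVec, Matrix.mul_assoc]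
  rw [hv, ← aux_tr, mulVec_mulVec,
    mul_nonsing_inv _ ((isUnit_iff_isUnit_det _).1 hR), one_mulVec]

/-- If `Φ(β)ᵀC` and `Φ(σ₁)ᵀNᵀΦ(β)ᵀC` lie in the range of `W`, then the bilinear
transfer functions interpolate: `F_N(σ₁, β) = F̂_N(σ₁, β)`. -/
theorem stmt_6 {n r : ℕ}
    (E A N : Matrix (Fin n) (Fin n) ℂ) (B C : Fin n → ℂ)
    (V W : Matrix (Fin n) (Fin r) ℂ) (σ₁ β : ℂ)
    (hfull1 : IsUnit (σ₁ • E - A)) (hfull2 : IsUnit (β • E - A))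
    (hred1 : IsUnit (σ₁ • (Wᵀ * E * V) - Wᵀ * A * V))
    (hred2 : IsUnit (β • (Wᵀ * E * V) - Wᵀ * A * V))
    (hW1 : ∃ z : Fin r → ℂ, ((β • E - A)⁻¹)ᵀ *ᵥ C = W *ᵥ z)
    (hW2 : ∃ z : Fin r → ℂ,
      ((σ₁ • E - A)⁻¹)ᵀ *ᵥ (Nᵀ *ᵥ (((β • E - A)⁻¹)ᵀ *ᵥ C)) = W *ᵥ z) :
    C ⬝ᵥ ((β • E - A)⁻¹ *ᵥ (N *ᵥ ((σ₁ • E - A)⁻¹ *ᵥ B)))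
      = (Vᵀ *ᵥ C) ⬝ᵥ ((β • (Wᵀ * E * V) - Wᵀ * A * V)⁻¹ *ᵥ
          ((Wᵀ * N * V) *ᵥ ((σ₁ • (Wᵀ * E * V) - Wᵀ * A * V)⁻¹ *ᵥ (Wᵀ *ᵥ B)))) := by
  obtain ⟨z1, h1⟩ := hW1
  obtain ⟨z2, h2⟩ := hW2
  rw [aux_red E A V W β hfull2 hred2 C z1 h1]
  rw [aux_tr (β • E - A)⁻¹, aux_tr N, aux_tr (σ₁ • E - A)⁻¹, h2]
  rw [h1] at h2
  have h3 := aux_red E A V W σ₁ hfull1 hred1 _ z2 h2 (Wᵀ *ᵥ B)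
  rw [aux_tr (Wᵀ * N * V)]
  have e : (Wᵀ * N * V)ᵀ *ᵥ z1 = Vᵀ *ᵥ (Nᵀ *ᵥ (W *ᵥ z1)) := by
    simp [transpose_mul, mulVec_mulVec, Matrix.mul_assoc]
  rw [e, h3, aux_tr Wᵀ, transpose_transpose]
end

section
/- Let σ₁, σ₂, σ₃ ∈ ℂ be such that σᵢE − A and σᵢÊ − Â are invertible for i = 1, 2, 3. Suppose Φ(σ₁)B, Φ(σ₂)B, and Φ(σ₃)H(Φ(σ₂)B ⊗ Φ(σ₁)B) all lie in the range of V. Then the quadratic transfer functions interpolate: F_H(σ₁, σ₂, σ₃) = F̂_H(σ₁, σ₂, σ₃). -/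
open Matrix
open scoped Kronecker

theorem aux_proj {n r : ℕ} (E A : Matrix (Fin n) (Fin n) ℂ) (V W : Matrix (Fin n) (Fin r) ℂ)
    (s : ℂ) (b : Fin n → ℂ) (z : Fin r → ℂ) (hf : IsUnit (s • E - A))
    (hr : IsUnit (s • (Wᵀ * E * V) - Wᵀ * A * V)) (h : (s • E - A)⁻¹ *ᵥ b = V *ᵥ z) :
    (s • (Wᵀ * E * V) - Wᵀ * A * V)⁻¹ *ᵥ (Wᵀ *ᵥ b) = z := by
  have hb : b = (s • E - A) *ᵥ (V *ᵥ z) := by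
    rw [← h, mulVec_mulVec, mul_nonsing_inv _ ((isUnit_iff_isUnit_det _).1 hf), one_mulVec]
  have hK : s • (Wᵀ * E * V) - Wᵀ * A * V = Wᵀ * (s • E - A) * V := by
    rw [Matrix.mul_sub, Matrix.sub_mul, Matrix.mul_smul, Matrix.smul_mul]
  have h2 : Wᵀ *ᵥ b = (s • (Wᵀ * E * V) - Wᵀ * A * V) *ᵥ z := by
    rw [hK, hb]; simp only [mulVec_mulVec, Matrix.mul_assoc]
  rw [h2, mulVec_mulVec, nonsing_inv_mul _ ((isUnit_iff_isUnit_det _).1 hr), one_mulVec]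

theorem aux_kron {n r : ℕ} (V : Matrix (Fin n) (Fin r) ℂ) (x y : Fin r → ℂ) :
    ((V ⊗ₖ V) *ᵥ fun ji : Fin r × Fin r => x ji.1 * y ji.2)
      = fun ji : Fin n × Fin n => (V *ᵥ x) ji.1 * (V *ᵥ y) ji.2 := by
  ext ⟨j, i⟩
  simp only [mulVec, dotProduct, Fintype.sum_prod_type, kroneckerMap_apply,
    Finset.sum_mul_sum]
  refine Finset.sum_congr rfl fun a _ => Finset.sum_congr rfl fun b _ => by ring

/-- If `Φ(σ₁)B`, `Φ(σ₂)B` and `Φ(σ₃)H(Φ(σ₂)B ⊗ Φ(σ₁)B)` lie in the range of `V`,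
then the quadratic transfer functions interpolate:
`F_H(σ₁, σ₂, σ₃) = F̂_H(σ₁, σ₂, σ₃)`. -/
theorem stmt_7 {n r : ℕ}
    (E A : Matrix (Fin n) (Fin n) ℂ) (H : Matrix (Fin n) (Fin n × Fin n) ℂ)
    (B C : Fin n → ℂ) (V W : Matrix (Fin n) (Fin r) ℂ) (σ₁ σ₂ σ₃ : ℂ)
    (hfull1 : IsUnit (σ₁ • E - A)) (hfull2 : IsUnit (σ₂ • E - A))
    (hfull3 : IsUnit (σ₃ • E - A))
    (hred1 : IsUnit (σ₁ • (Wᵀ * E * V) - Wᵀ * A * V))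
    (hred2 : IsUnit (σ₂ • (Wᵀ * E * V) - Wᵀ * A * V))
    (hred3 : IsUnit (σ₃ • (Wᵀ * E * V) - Wᵀ * A * V))
    (hV1 : ∃ z : Fin r → ℂ, (σ₁ • E - A)⁻¹ *ᵥ B = V *ᵥ z)
    (hV2 : ∃ z : Fin r → ℂ, (σ₂ • E - A)⁻¹ *ᵥ B = V *ᵥ z)
    (hV3 : ∃ z : Fin r → ℂ,
      (σ₃ • E - A)⁻¹ *ᵥ (H *ᵥ fun ji : Fin n × Fin n =>
        ((σ₂ • E - A)⁻¹ *ᵥ B) ji.1 * ((σ₁ • E - A)⁻¹ *ᵥ B) ji.2) = V *ᵥ z) :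
    C ⬝ᵥ ((σ₃ • E - A)⁻¹ *ᵥ (H *ᵥ fun ji : Fin n × Fin n =>
        ((σ₂ • E - A)⁻¹ *ᵥ B) ji.1 * ((σ₁ • E - A)⁻¹ *ᵥ B) ji.2))
      = (Vᵀ *ᵥ C) ⬝ᵥ ((σ₃ • (Wᵀ * E * V) - Wᵀ * A * V)⁻¹ *ᵥ
          ((Wᵀ * H * (V ⊗ₖ V)) *ᵥ fun ji : Fin r × Fin r =>
            ((σ₂ • (Wᵀ * E * V) - Wᵀ * A * V)⁻¹ *ᵥ (Wᵀ *ᵥ B)) ji.1 *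
            ((σ₁ • (Wᵀ * E * V) - Wᵀ * A * V)⁻¹ *ᵥ (Wᵀ *ᵥ B)) ji.2)) := by
  obtain ⟨z1, h1⟩ := hV1
  obtain ⟨z2, h2⟩ := hV2
  obtain ⟨z3, h3⟩ := hV3
  rw [aux_proj E A V W σ₁ B z1 hfull1 hred1 h1, aux_proj E A V W σ₂ B z2 hfull2 hred2 h2,
    ← mulVec_mulVec, aux_kron, ← mulVec_mulVec]
  rw [h3]
  rw [h1, h2] at h3
  rw [aux_proj E A V W σ₃ _ z3 hfull3 hred3 h3, mulVec_transpose, dotProduct_mulVec]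
end

section
/- Let σ ∈ ℂ be such that σE − A and σÊ − Â are invertible, and let b ∈ ℂᵐ be a right tangential direction. Suppose the vector Φ(σ)Bb lies in the range of V. Then the transfer functions interpolate tangentially: F_L(σ) b = F̂_L(σ) b (equality of vectors in ℂ^q). -/
open Matrix

/-- Right tangential interpolation: if `Φ(σ)Bb ∈ range V`, then
`F_L(σ) b = F̂_L(σ) b`. -/
theorem stmt_10 {n r m q : ℕ}
    (E A : Matrix (Fin n) (Fin n) ℂ) (B : Matrix (Fin n) (Fin m) ℂ)
    (C : Matrix (Fin q) (Fin n) ℂ) (V W : Matrix (Fin n) (Fin r) ℂ)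
    (σ : ℂ) (b : Fin m → ℂ)
    (hfull : IsUnit (σ • E - A))
    (hred : IsUnit (σ • (Wᵀ * E * V) - Wᵀ * A * V))
    (hV : ∃ z : Fin r → ℂ, (σ • E - A)⁻¹ *ᵥ (B *ᵥ b) = V *ᵥ z) :
    (C * (σ • E - A)⁻¹ * B) *ᵥ b
      = ((C * V) * (σ • (Wᵀ * E * V) - Wᵀ * A * V)⁻¹ * (Wᵀ * B)) *ᵥ b := by
  obtain ⟨z, hz⟩ := hV
  have hK : σ • (Wᵀ * E * V) - Wᵀ * A * V = Wᵀ * (σ • E - A) * V := by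
    simp [Matrix.mul_sub, Matrix.sub_mul]
  have h1 : B *ᵥ b = (σ • E - A) *ᵥ (V *ᵥ z) := by
    rw [← hz, Matrix.mulVec_mulVec,
      Matrix.mul_nonsing_inv _ ((Matrix.isUnit_iff_isUnit_det _).mp hfull), Matrix.one_mulVec]
  have h2 : (Wᵀ * B) *ᵥ b = (σ • (Wᵀ * E * V) - Wᵀ * A * V) *ᵥ z := by
    rw [hK, ← Matrix.mulVec_mulVec, h1, Matrix.mulVec_mulVec, Matrix.mulVec_mulVec]
  rw [← Matrix.mulVec_mulVec, ← Matrix.mulVec_mulVec, hz, ← Matrix.mulVec_mulVec, h2,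
    ← Matrix.mulVec_mulVec, Matrix.mulVec_mulVec z,
    Matrix.mulVec_mulVec z (σ • (Wᵀ * E * V) - Wᵀ * A * V)⁻¹,
    Matrix.nonsing_inv_mul _ ((Matrix.isUnit_iff_isUnit_det _).mp hred), Matrix.one_mulVec]
end

section
/- Let σ ∈ ℂ be such that σE − A and σÊ − Â are invertible, and let c ∈ ℂ^q be a left tangential direction. Suppose the vector Φ(σ)ᵀCᵀc lies in the range of W. Then the transfer functions interpolate tangentially: cᵀ F_L(σ) = cᵀ F̂_L(σ) (equality of row vectors in ℂᵐ). -/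
open Matrix

/-- Left tangential interpolation: if `Φ(σ)ᵀCᵀc ∈ range W`, then
`cᵀ F_L(σ) = cᵀ F̂_L(σ)`. -/
theorem stmt_11 {n r m q : ℕ}
    (E A : Matrix (Fin n) (Fin n) ℂ) (B : Matrix (Fin n) (Fin m) ℂ)
    (C : Matrix (Fin q) (Fin n) ℂ) (V W : Matrix (Fin n) (Fin r) ℂ)
    (σ : ℂ) (c : Fin q → ℂ)
    (hfull : IsUnit (σ • E - A))
    (hred : IsUnit (σ • (Wᵀ * E * V) - Wᵀ * A * V))
    (hW : ∃ z : Fin r → ℂ, ((σ • E - A)⁻¹)ᵀ *ᵥ (Cᵀ *ᵥ c) = W *ᵥ z) :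
    c ᵥ* (C * (σ • E - A)⁻¹ * B)
      = c ᵥ* ((C * V) * (σ • (Wᵀ * E * V) - Wᵀ * A * V)⁻¹ * (Wᵀ * B)) := by
  obtain ⟨z, hz⟩ := hW
  have hK : (σ • (Wᵀ * E * V) - Wᵀ * A * V) = Wᵀ * (σ • E - A) * V := by
    simp [Matrix.mul_sub, Matrix.sub_mul]
  rw [hK] at hred ⊢
  generalize σ • E - A = K at *
  have h1 : c ᵥ* C ᵥ* K⁻¹ = z ᵥ* Wᵀ := by
    rw [Matrix.mulVec_transpose, Matrix.mulVec_transpose] at hz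
    rw [hz, Matrix.vecMul_transpose]
  have hKd := (Matrix.isUnit_iff_isUnit_det _).1 hfull
  have hRd := (Matrix.isUnit_iff_isUnit_det _).1 hred
  have h2 : c ᵥ* C = z ᵥ* (Wᵀ * K) := by
    rw [← Matrix.vecMul_vecMul, ← h1, Matrix.vecMul_vecMul (c ᵥ* C),
      Matrix.nonsing_inv_mul _ hKd, Matrix.vecMul_one]
  have h3 : c ᵥ* (C * V) = z ᵥ* (Wᵀ * K * V) := by
    rw [← Matrix.vecMul_vecMul, h2, Matrix.vecMul_vecMul]
  calc c ᵥ* (C * K⁻¹ * B) = z ᵥ* (Wᵀ * B) := by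
        rw [← Matrix.vecMul_vecMul, ← Matrix.vecMul_vecMul, h1, Matrix.vecMul_vecMul]
    _ = _ := by
        rw [← Matrix.vecMul_vecMul c, ← Matrix.vecMul_vecMul c, h3,
          Matrix.vecMul_vecMul z, Matrix.mul_nonsing_inv _ hRd, Matrix.vecMul_one]
end

section
/- Let σ ∈ ℂ be such that σE − A and σÊ − Â are invertible, and let b ∈ ℂᵐ, c ∈ ℂ^q be tangential directions. Suppose Φ(σ)Bb lies in the range of V and Φ(σ)ᵀCᵀc lies in the range of W. Then the Hermite tangential interpolation condition holds: the derivative of s ↦ cᵀ F_L(s) b at σ equals the derivative of s ↦ cᵀ F̂_L(s) b at σ (both scalar functions being differentiable at σ, since invertibility holds on a neighborhood of σ). -/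
open Matrix

section helper
attribute [local instance] Matrix.linftyOpNormedRing Matrix.linftyOpNormedAlgebra

theorem helper_inv {n : ℕ} (E A : Matrix (Fin n) (Fin n) ℂ) (σ : ℂ)
    (h : IsUnit (σ • E - A)) :
    HasDerivAt (fun s : ℂ => (s • E - A)⁻¹) (-((σ • E - A)⁻¹ * E * (σ • E - A)⁻¹)) σ := by
  obtain ⟨u, hu⟩ := h
  have h1 : HasDerivAt (fun s : ℂ => s • E - A) E σ := by
    have h0 := ((hasDerivAt_id σ).smul_const E).sub_const A
    rw [one_smul] at h0
    exact h0
  have h2 := hasFDerivAt_ringInverse (𝕜 := ℂ) u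
  rw [hu] at h2
  have h3 := h2.comp_hasDerivAt σ h1
  have h4 : ((u⁻¹ : (Matrix (Fin n) (Fin n) ℂ)ˣ) : Matrix (Fin n) (Fin n) ℂ)
      = (σ • E - A)⁻¹ := by
    rw [← hu, Matrix.coe_units_inv]
  rw [h4] at h3
  simp only [Matrix.nonsing_inv_eq_ringInverse] at h3 ⊢
  simp [Function.comp_def] at h3
  exact h3

theorem helper_deriv {n m q : ℕ} (E A : Matrix (Fin n) (Fin n) ℂ) (B : Matrix (Fin n) (Fin m) ℂ)
    (C : Matrix (Fin q) (Fin n) ℂ) (σ : ℂ) (b : Fin m → ℂ) (c : Fin q → ℂ)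
    (h : IsUnit (σ • E - A)) :
    HasDerivAt (fun s : ℂ => c ⬝ᵥ ((C * (s • E - A)⁻¹ * B) *ᵥ b))
      (-((((σ • E - A)⁻¹)ᵀ *ᵥ (Cᵀ *ᵥ c)) ⬝ᵥ (E *ᵥ ((σ • E - A)⁻¹ *ᵥ (B *ᵥ b))))) σ := by
  let L : Matrix (Fin n) (Fin n) ℂ →ₗ[ℂ] ℂ :=
    { toFun := fun M => c ⬝ᵥ ((C * M * B) *ᵥ b)
      map_add' := fun M N => by
        simp [Matrix.mul_add, Matrix.add_mul, Matrix.add_mulVec]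
      map_smul' := fun a M => by
        simp [Matrix.smul_mulVec] }
  have h3 := (LinearMap.toContinuousLinearMap L).hasFDerivAt.comp_hasDerivAt σ
    (helper_inv E A σ h)
  convert! h3 using 1
  change _ = c ⬝ᵥ ((C * -((σ • E - A)⁻¹ * E * (σ • E - A)⁻¹) * B) *ᵥ b)
  simp only [Matrix.mul_neg, Matrix.neg_mul, Matrix.neg_mulVec, dotProduct_neg,
    Matrix.mulVec_transpose, ← Matrix.dotProduct_mulVec, Matrix.mulVec_mulVec, Matrix.mul_assoc]

end helper

/-- Hermite tangential interpolation: if `Φ(σ)Bb ∈ range V` and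
`Φ(σ)ᵀCᵀc ∈ range W`, then the derivatives of `s ↦ cᵀ F_L(s) b` and
`s ↦ cᵀ F̂_L(s) b` agree at `σ` (both being differentiable there). -/
theorem stmt_12 {n r m q : ℕ}
    (E A : Matrix (Fin n) (Fin n) ℂ) (B : Matrix (Fin n) (Fin m) ℂ)
    (C : Matrix (Fin q) (Fin n) ℂ) (V W : Matrix (Fin n) (Fin r) ℂ)
    (σ : ℂ) (b : Fin m → ℂ) (c : Fin q → ℂ)
    (hfull : IsUnit (σ • E - A))
    (hred : IsUnit (σ • (Wᵀ * E * V) - Wᵀ * A * V))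
    (hV : ∃ z : Fin r → ℂ, (σ • E - A)⁻¹ *ᵥ (B *ᵥ b) = V *ᵥ z)
    (hW : ∃ z : Fin r → ℂ, ((σ • E - A)⁻¹)ᵀ *ᵥ (Cᵀ *ᵥ c) = W *ᵥ z) :
    DifferentiableAt ℂ (fun s : ℂ => c ⬝ᵥ ((C * (s • E - A)⁻¹ * B) *ᵥ b)) σ ∧
    DifferentiableAt ℂ (fun s : ℂ =>
      c ⬝ᵥ (((C * V) * (s • (Wᵀ * E * V) - Wᵀ * A * V)⁻¹ * (Wᵀ * B)) *ᵥ b)) σ ∧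
    deriv (fun s : ℂ => c ⬝ᵥ ((C * (s • E - A)⁻¹ * B) *ᵥ b)) σ
      = deriv (fun s : ℂ =>
          c ⬝ᵥ (((C * V) * (s • (Wᵀ * E * V) - Wᵀ * A * V)⁻¹ * (Wᵀ * B)) *ᵥ b)) σ := by
  have hd1 := helper_deriv E A B C σ b c hfull
  have hd2 := helper_deriv (Wᵀ * E * V) (Wᵀ * A * V) (Wᵀ * B) (C * V) σ b c hred
  refine ⟨hd1.differentiableAt, hd2.differentiableAt, ?_⟩
  rw [hd1.deriv, hd2.deriv]
  obtain ⟨z, hz⟩ := hV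
  obtain ⟨w, hw⟩ := hW
  have hM : σ • (Wᵀ * E * V) - Wᵀ * A * V = Wᵀ * (σ • E - A) * V := by
    simp [Matrix.mul_sub, Matrix.sub_mul]
  have hf := (Matrix.isUnit_iff_isUnit_det _).1 hfull
  have hr := (Matrix.isUnit_iff_isUnit_det _).1 hred
  have hz' : (σ • (Wᵀ * E * V) - Wᵀ * A * V)⁻¹ *ᵥ ((Wᵀ * B) *ᵥ b) = z := by
    have e : (Wᵀ * B) *ᵥ b = (σ • (Wᵀ * E * V) - Wᵀ * A * V) *ᵥ z := by
      rw [hM, ← Matrix.mulVec_mulVec, ← Matrix.mulVec_mulVec, ← hz, ← Matrix.mulVec_mulVec,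
        Matrix.mulVec_mulVec _ (σ • E - A), Matrix.mul_nonsing_inv _ hf, Matrix.one_mulVec]
    rw [e, Matrix.mulVec_mulVec, Matrix.nonsing_inv_mul _ hr, Matrix.one_mulVec]
  have hw' : ((σ • (Wᵀ * E * V) - Wᵀ * A * V)⁻¹)ᵀ *ᵥ ((C * V)ᵀ *ᵥ c) = w := by
    have e : (C * V)ᵀ *ᵥ c = (σ • (Wᵀ * E * V) - Wᵀ * A * V)ᵀ *ᵥ w := by
      rw [hM, Matrix.transpose_mul, Matrix.transpose_mul, Matrix.transpose_mul,
        Matrix.transpose_transpose, ← Matrix.mulVec_mulVec, ← Matrix.mulVec_mulVec,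
        ← Matrix.mulVec_mulVec, ← hw, Matrix.mulVec_mulVec _ (σ • E - A)ᵀ,
        ← Matrix.transpose_mul, Matrix.nonsing_inv_mul _ hf, Matrix.transpose_one,
        Matrix.one_mulVec]
    rw [e, Matrix.mulVec_mulVec, ← Matrix.transpose_mul, Matrix.mul_nonsing_inv _ hr,
      Matrix.transpose_one, Matrix.one_mulVec]
  rw [hz', hw', hz, hw, ← Matrix.mulVec_mulVec, ← Matrix.mulVec_mulVec,
    Matrix.dotProduct_mulVec w Wᵀ, Matrix.vecMul_transpose]
end

section
/- Let σ ∈ ℂ be such that σE − A and σÊ − Â are invertible, and let b ∈ ℂᵐ. Set v := Φ(σ)Bb ∈ ℂⁿ and v̂ := Φ̂(σ)B̂b ∈ ℂʳ. Suppose v lies in the range of V, and for every j ∈ {1, …, m} the vector Φ(σ) N (e_j ⊗ v) lies in the range of V, where e_j ∈ ℂᵐ is the j-th standard basis vector. Then for every j ∈ {1, …, m}: C Φ(σ) N (e_j ⊗ v) = Ĉ Φ̂(σ) N̂ (e_j ⊗ v̂), i.e., the tangentially evaluated bilinear transfer functions F_N(σ, σ)(I_m ⊗ b) and F̂_N(σ,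 σ)(I_m ⊗ b) coincide. -/
open Matrix
open scoped Kronecker

theorem proj_aux {n r : ℕ} (K : Matrix (Fin n) (Fin n) ℂ) (V W : Matrix (Fin n) (Fin r) ℂ)
    (R : Matrix (Fin r) (Fin r) ℂ) (hR : R = Wᵀ * K * V) (hK : IsUnit K) (hr : IsUnit R)
    (x : Fin n → ℂ) (z : Fin r → ℂ) (h : K⁻¹ *ᵥ x = V *ᵥ z) :
    R⁻¹ *ᵥ (Wᵀ *ᵥ x) = z := by
  have hx : x = K *ᵥ (V *ᵥ z) := by
    rw [← h, mulVec_mulVec, mul_nonsing_inv _ ((isUnit_iff_isUnit_det _).1 hK), one_mulVec]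
  have h2 : Wᵀ *ᵥ x = R *ᵥ z := by
    rw [hx, hR]; simp only [mulVec_mulVec, Matrix.mul_assoc]
  rw [h2, mulVec_mulVec, nonsing_inv_mul _ ((isUnit_iff_isUnit_det _).1 hr), one_mulVec]

theorem kron_aux {n r m : ℕ} (V : Matrix (Fin n) (Fin r) ℂ) (w : Fin m → ℂ) (z : Fin r → ℂ) :
    ((1 : Matrix (Fin m) (Fin m) ℂ) ⊗ₖ V) *ᵥ (fun ji : Fin m × Fin r => w ji.1 * z ji.2)
      = fun ji : Fin m × Fin n => w ji.1 * (V *ᵥ z) ji.2 := by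
  ext ⟨j, i⟩
  simp only [mulVec, dotProduct, Fintype.sum_prod_type, kroneckerMap_apply, Matrix.one_apply]
  rw [Finset.sum_eq_single j]
  · rw [Finset.mul_sum]
    refine Finset.sum_congr rfl fun k _ => ?_
    simp; ring
  · intro k _ hk
    simp [hk.symm]
  · simp

/-- Tangential interpolation of the bilinear transfer function: with
`v := Φ(σ)Bb` and `v̂ := Φ̂(σ)B̂b`, if `v` and every `Φ(σ)N(e_j ⊗ v)` lie in the
range of `V`, then `CΦ(σ)N(e_j ⊗ v) = ĈΦ̂(σ)N̂(e_j ⊗ v̂)` for every `j`. -/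
theorem stmt_13 {n r m q : ℕ}
    (E A : Matrix (Fin n) (Fin n) ℂ) (B : Matrix (Fin n) (Fin m) ℂ)
    (C : Matrix (Fin q) (Fin n) ℂ) (N : Matrix (Fin n) (Fin m × Fin n) ℂ)
    (V W : Matrix (Fin n) (Fin r) ℂ) (σ : ℂ) (b : Fin m → ℂ)
    (hfull : IsUnit (σ • E - A))
    (hred : IsUnit (σ • (Wᵀ * E * V) - Wᵀ * A * V))
    (hVv : ∃ z : Fin r → ℂ, (σ • E - A)⁻¹ *ᵥ (B *ᵥ b) = V *ᵥ z)
    (hVN : ∀ j : Fin m, ∃ z : Fin r → ℂ,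
      (σ • E - A)⁻¹ *ᵥ (N *ᵥ fun ji : Fin m × Fin n =>
        (Pi.single j 1 : Fin m → ℂ) ji.1 * ((σ • E - A)⁻¹ *ᵥ (B *ᵥ b)) ji.2) = V *ᵥ z) :
    ∀ j : Fin m,
      C *ᵥ ((σ • E - A)⁻¹ *ᵥ (N *ᵥ fun ji : Fin m × Fin n =>
          (Pi.single j 1 : Fin m → ℂ) ji.1 * ((σ • E - A)⁻¹ *ᵥ (B *ᵥ b)) ji.2))
        = (C * V) *ᵥ ((σ • (Wᵀ * E * V) - Wᵀ * A * V)⁻¹ *ᵥ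
            ((Wᵀ * N * ((1 : Matrix (Fin m) (Fin m) ℂ) ⊗ₖ V)) *ᵥ
              fun ji : Fin m × Fin r => (Pi.single j 1 : Fin m → ℂ) ji.1 *
                ((σ • (Wᵀ * E * V) - Wᵀ * A * V)⁻¹ *ᵥ ((Wᵀ * B) *ᵥ b)) ji.2)) := by
  intro j
  have hR : σ • (Wᵀ * E * V) - Wᵀ * A * V = Wᵀ * (σ • E - A) * V := by
    simp [Matrix.mul_sub, Matrix.sub_mul]
  obtain ⟨z, hz⟩ := hVv
  obtain ⟨y, hy⟩ := hVN j
  have h1 := proj_aux _ V W _ hR hfull hred _ z hz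
  have h2 := proj_aux _ V W _ hR hfull hred _ y hy
  rw [hy, ← mulVec_mulVec b Wᵀ B, h1, ← mulVec_mulVec _ (Wᵀ * N), kron_aux, ← hz,
    ← mulVec_mulVec _ Wᵀ N, h2, mulVec_mulVec]
end

section
/- Let k ∈ ℕ and let σ₁, …, σ_k, μ₁, …, μ_k ∈ ℂ be such that sE − A is invertible for every s ∈ {σ₁, …, σ_k, μ₁, …, μ_k} and μᵢ ≠ σⱼ for all i, j. Let V ∈ ℂ^{n×k} have j-th column Φ(σⱼ)B and W ∈ ℂ^{n×k} have i-th column Φ(μᵢ)ᵀC. Then the Loewner matrix 𝕃 := −WᵀEV satisfies 𝕃(i, j) = (H(μᵢ) − H(σⱼ)) / (μᵢ − σⱼ) for all i, j, where H(s) := Cᵀ Φ(s) B is the transfer function. -/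
open Matrix

/-- The Loewner matrix `𝕃 = −WᵀEV` built from the interpolation data satisfies
`𝕃(i,j) = (H(μᵢ) − H(σⱼ)) / (μᵢ − σⱼ)`. -/
theorem stmt_14 {n k : ℕ}
    (E A : Matrix (Fin n) (Fin n) ℂ) (B C : Fin n → ℂ)
    (σ μ : Fin k → ℂ)
    (hσ : ∀ j, IsUnit (σ j • E - A)) (hμ : ∀ i, IsUnit (μ i • E - A))
    (hne : ∀ i j, μ i ≠ σ j)
    (V W : Matrix (Fin n) (Fin k) ℂ)
    (hV : ∀ j, (fun i => V i j) = (σ j • E - A)⁻¹ *ᵥ B)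
    (hW : ∀ i, (fun l => W l i) = ((μ i • E - A)⁻¹)ᵀ *ᵥ C) :
    ∀ i j, (-(Wᵀ * E * V)) i j
      = (C ⬝ᵥ ((μ i • E - A)⁻¹ *ᵥ B) - C ⬝ᵥ ((σ j • E - A)⁻¹ *ᵥ B))
          / (μ i - σ j) := by
  intro i j
  have hd : μ i - σ j ≠ 0 := sub_ne_zero.mpr (hne i j)
  have hP := (Matrix.isUnit_iff_isUnit_det _).mp (hμ i)
  have hQ := (Matrix.isUnit_iff_isUnit_det _).mp (hσ j)
  have hent : (Wᵀ * E * V) i j = (fun l => W l i) ⬝ᵥ (E *ᵥ (fun l => V l j)) := by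
    rw [Matrix.mul_assoc]
    rfl
  have hQP : (σ j • E - A) - (μ i • E - A) = -((μ i - σ j) • E) := by
    rw [sub_smul]; abel
  have hres : (μ i • E - A)⁻¹ - (σ j • E - A)⁻¹
      = -((μ i - σ j) • ((μ i • E - A)⁻¹ * E * (σ j • E - A)⁻¹)) := by
    have h : (μ i • E - A)⁻¹ * ((σ j • E - A) - (μ i • E - A)) * (σ j • E - A)⁻¹
        = (μ i • E - A)⁻¹ - (σ j • E - A)⁻¹ := by
      rw [Matrix.mul_sub, Matrix.sub_mul, Matrix.nonsing_inv_mul _ hP, Matrix.one_mul,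
        Matrix.mul_assoc, Matrix.mul_nonsing_inv _ hQ, Matrix.mul_one]
    rw [← h, hQP]
    simp only [Matrix.mul_neg, Matrix.neg_mul, Matrix.mul_smul, Matrix.smul_mul]
  rw [eq_div_iff hd, ← dotProduct_sub, ← Matrix.sub_mulVec, hres, Matrix.neg_apply, hent,
    hV, hW, Matrix.mulVec_transpose, ← Matrix.dotProduct_mulVec, Matrix.neg_mulVec,
    Matrix.smul_mulVec, dotProduct_neg, dotProduct_smul, Matrix.mulVec_mulVec,
    Matrix.mulVec_mulVec, Matrix.mul_assoc, smul_eq_mul]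
  ring
end

section
/- Let k ∈ ℕ and let σ₁, …, σ_k, μ₁, …, μ_k ∈ ℂ be such that sE − A is invertible for every s ∈ {σ₁, …, σ_k, μ₁, …, μ_k} and μᵢ ≠ σⱼ for all i, j. Let V ∈ ℂ^{n×k} have j-th column Φ(σⱼ)B and W ∈ ℂ^{n×k} have i-th column Φ(μᵢ)ᵀC. Then the shifted Loewner matrix 𝕃_s := −WᵀAV satisfies 𝕃_s(i, j) = (μᵢ H(μᵢ) − σⱼ H(σⱼ)) / (μᵢ − σⱼ) for all i, j, where H(s) := Cᵀ Φ(s) B is the transfer function. -/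
open Matrix

/-- The shifted Loewner matrix `𝕃ₛ = −WᵀAV` built from the interpolation data
satisfies `𝕃ₛ(i,j) = (μᵢH(μᵢ) − σⱼH(σⱼ)) / (μᵢ − σⱼ)`. -/
theorem stmt_15 {n k : ℕ}
    (E A : Matrix (Fin n) (Fin n) ℂ) (B C : Fin n → ℂ)
    (σ μ : Fin k → ℂ)
    (hσ : ∀ j, IsUnit (σ j • E - A)) (hμ : ∀ i, IsUnit (μ i • E - A))
    (hne : ∀ i j, μ i ≠ σ j)
    (V W : Matrix (Fin n) (Fin k) ℂ)
    (hV : ∀ j, (fun i => V i j) = (σ j • E - A)⁻¹ *ᵥ B)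
    (hW : ∀ i, (fun l => W l i) = ((μ i • E - A)⁻¹)ᵀ *ᵥ C) :
    ∀ i j, (-(Wᵀ * A * V)) i j
      = (μ i * (C ⬝ᵥ ((μ i • E - A)⁻¹ *ᵥ B)) - σ j * (C ⬝ᵥ ((σ j • E - A)⁻¹ *ᵥ B)))
          / (μ i - σ j) := by
  intro i j
  have hd : μ i - σ j ≠ 0 := sub_ne_zero.mpr (hne i j)
  have hP : (μ i • E - A)⁻¹ * (μ i • E - A) = 1 :=
    Matrix.nonsing_inv_mul _ ((Matrix.isUnit_iff_isUnit_det _).mp (hμ i))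
  have hQ : (σ j • E - A) * (σ j • E - A)⁻¹ = 1 :=
    Matrix.mul_nonsing_inv _ ((Matrix.isUnit_iff_isUnit_det _).mp (hσ j))
  have hV' := hV j
  have hW' := hW i
  generalize (μ i • E - A)⁻¹ = P at *
  generalize (σ j • E - A)⁻¹ = Q at *
  have key : μ i • P - σ j • Q = (-(μ i - σ j)) • (P * A * Q) := by
    have h1 : μ i • P - σ j • Q
        = μ i • (P * ((σ j • E - A) * Q)) - σ j • ((P * (μ i • E - A)) * Q) := by
      rw [hP, hQ, Matrix.mul_one, Matrix.one_mul]
    rw [h1]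
    simp only [Matrix.mul_sub, Matrix.sub_mul, Matrix.mul_smul, Matrix.smul_mul,
      Matrix.mul_assoc]
    module
  have h2 : (Wᵀ * A * V) i j = C ⬝ᵥ ((P * A * Q) *ᵥ B) := by
    have h3 : (Wᵀ * A * V) i j = (fun l => W l i) ⬝ᵥ (A *ᵥ (fun l => V l j)) := by
      rw [Matrix.mul_assoc]
      rfl
    rw [h3, hV', hW', Matrix.mulVec_transpose, ← Matrix.dotProduct_mulVec,
      Matrix.mulVec_mulVec, Matrix.mulVec_mulVec, Matrix.mul_assoc]
  have h4 : μ i * (C ⬝ᵥ (P *ᵥ B)) - σ j * (C ⬝ᵥ (Q *ᵥ B))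
      = C ⬝ᵥ ((μ i • P - σ j • Q) *ᵥ B) := by
    simp only [Matrix.sub_mulVec, Matrix.smul_mulVec, dotProduct_sub, dotProduct_smul,
      smul_eq_mul]
  rw [h4, key, Matrix.neg_apply, h2, Matrix.smul_mulVec, dotProduct_smul, smul_eq_mul]
  field_simp
end

section
/- Let E, A : ℝ → ℂ^{n×n}, B, C : ℝ → ℂⁿ be matrix/vector-valued functions of a real parameter p whose entries are differentiable at p₀ ∈ ℝ, and fix σ ∈ ℂ and projection matrices V, W ∈ ℂ^{n×r}. Write Φ(σ, p) := (σE(p) − A(p))⁻¹ and define the reduced parametric matrices Ê(p) := WᵀE(p)V, Â(p) := WᵀA(p)V, B̂(p) := WᵀB(p), Ĉ(p) := VᵀC(p), and Φ̂(σ, p) := (σÊ(p) − Â(p))⁻¹. Assume σE(p₀) − A(p₀) and σÊ(p₀) − Â(p₀) are invertible, Φ(σ, p₀)B(p₀) lies in the range of V, and Φ(σ, p₀)ᵀC(p₀) lies in the range of W. Then the parametric sensitivities of the transfer functions match: the derivative of p ↦ C(p)ᵀ Φ(σ, p) B(p) at p₀ equals the derivative of p ↦ Ĉ(p)ᵀ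 Φ̂(σ, p) B̂(p) at p₀ (both ℂ-valued functions of the real parameter p being differentiable at p₀, since invertibility holds on a neighborhood of p₀). -/
open Matrix

theorem aux_det {m : ℕ} (K : ℝ → Matrix (Fin m) (Fin m) ℂ) (p₀ : ℝ)
    (hK : ∀ i j, DifferentiableAt ℝ (fun p => K p i j) p₀) :
    DifferentiableAt ℝ (fun p => (K p).det) p₀ := by
  simp only [Matrix.det_apply']
  refine DifferentiableAt.fun_sum fun s _ => ?_
  refine DifferentiableAt.const_mul ?_ _
  exact DifferentiableAt.fun_finsetProd fun i _ => hK _ _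

theorem aux_inv {m : ℕ} (K : ℝ → Matrix (Fin m) (Fin m) ℂ) (p₀ : ℝ)
    (hK : ∀ i j, DifferentiableAt ℝ (fun p => K p i j) p₀) (hu : IsUnit (K p₀)) (i j : Fin m) :
    DifferentiableAt ℝ (fun p => (K p)⁻¹ i j) p₀ := by
  have hd : (K p₀).det ≠ 0 := ((Matrix.isUnit_iff_isUnit_det _).1 hu).ne_zero
  simp only [Matrix.inv_def, Matrix.smul_apply, smul_eq_mul, Ring.inverse_eq_inv',
    Matrix.adjugate_apply]
  refine DifferentiableAt.mul ((aux_det K p₀ hK).inv hd) (aux_det _ p₀ fun a b => ?_)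
  by_cases h : a = j
  · subst h
    simp only [Matrix.updateRow_self]
    exact differentiableAt_const _
  · simp only [Matrix.updateRow_ne h]
    exact hK a b

theorem aux_main {m : ℕ} (K : ℝ → Matrix (Fin m) (Fin m) ℂ) (b c : ℝ → Fin m → ℂ) (p₀ : ℝ)
    (hK : ∀ i j, DifferentiableAt ℝ (fun p => K p i j) p₀)
    (hb : ∀ i, DifferentiableAt ℝ (fun p => b p i) p₀)
    (hc : ∀ i, DifferentiableAt ℝ (fun p => c p i) p₀)
    (hu : IsUnit (K p₀)) (x y : Fin m → ℂ) (hx : K p₀ *ᵥ x = b p₀) (hy : y ᵥ* K p₀ = c p₀) :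
    DifferentiableAt ℝ (fun p => c p ⬝ᵥ x + y ⬝ᵥ b p - y ⬝ᵥ (K p *ᵥ x)) p₀ ∧
    HasDerivAt (fun p => c p ⬝ᵥ ((K p)⁻¹ *ᵥ b p))
      (deriv (fun p => c p ⬝ᵥ x + y ⬝ᵥ b p - y ⬝ᵥ (K p *ᵥ x)) p₀) p₀ := by
  have hL : DifferentiableAt ℝ (fun p => c p ⬝ᵥ x + y ⬝ᵥ b p - y ⬝ᵥ (K p *ᵥ x)) p₀ := by
    simp only [Matrix.mulVec, dotProduct]
    fun_prop
  refine ⟨hL, ?_⟩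
  have hg : ∀ i, DifferentiableAt ℝ (fun p => c p i - (y ᵥ* K p) i) p₀ := by
    intro i
    simp only [Matrix.vecMul, dotProduct]
    fun_prop
  have hh : ∀ i, DifferentiableAt ℝ (fun p => b p i - (K p *ᵥ x) i) p₀ := by
    intro i
    simp only [Matrix.mulVec, dotProduct]
    fun_prop
  have hR : HasDerivAt (fun p => (c p - y ᵥ* K p) ⬝ᵥ ((K p)⁻¹ *ᵥ (b p - K p *ᵥ x))) 0 p₀ := by
    have h1 : ∀ i j, HasDerivAt (fun p => (c p i - (y ᵥ* K p) i) *
        ((K p)⁻¹ i j * (b p j - (K p *ᵥ x) j))) 0 p₀ := by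
      intro i j
      have := (hg i).hasDerivAt.mul ((aux_inv K p₀ hK hu i j).hasDerivAt.mul (hh j).hasDerivAt)
      refine this.congr_deriv ?_
      simp [hx, hy]
    have h2 := HasDerivAt.fun_sum (u := Finset.univ) fun i _ =>
      HasDerivAt.fun_sum (u := Finset.univ) fun j _ => h1 i j
    simpa [Matrix.mulVec, dotProduct, Finset.mul_sum] using h2
  have hsum := hL.hasDerivAt.add hR
  rw [add_zero] at hsum
  refine hsum.congr_of_eventuallyEq ?_
  have hne : ∀ᶠ p in nhds p₀, (K p).det ≠ 0 :=
    (aux_det K p₀ hK).continuousAt.eventually_ne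
      ((Matrix.isUnit_iff_isUnit_det _).1 hu).ne_zero
  filter_upwards [hne] with p hp
  have hup : IsUnit (K p).det := isUnit_iff_ne_zero.2 hp
  have e1 : (K p)⁻¹ *ᵥ (K p *ᵥ x) = x := by
    rw [Matrix.mulVec_mulVec, Matrix.nonsing_inv_mul _ hup, Matrix.one_mulVec]
  have e2 : ∀ v, (y ᵥ* K p) ⬝ᵥ ((K p)⁻¹ *ᵥ v) = y ⬝ᵥ v := by
    intro v
    rw [← Matrix.dotProduct_mulVec, Matrix.mulVec_mulVec, Matrix.mul_nonsing_inv _ hup,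
      Matrix.one_mulVec]
  simp only [Pi.add_apply, Matrix.mulVec_sub, sub_dotProduct, dotProduct_sub, e1, e2]
  rw [← Matrix.dotProduct_mulVec]
  ring

/-- Matching of parametric sensitivities: if the entries of `E, A, B, C` are
differentiable in the parameter at `p₀`, invertibility holds at `p₀`, and
`Φ(σ,p₀)B(p₀) ∈ range V`, `Φ(σ,p₀)ᵀC(p₀) ∈ range W`, then
`p ↦ F_L(σ,p)` and `p ↦ F̂_L(σ,p)` are differentiable at `p₀` with equal
derivatives. -/
theorem stmt_18 {n r : ℕ}
    (E A : ℝ → Matrix (Fin n) (Fin n) ℂ) (B C : ℝ → (Fin n → ℂ))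
    (V W : Matrix (Fin n) (Fin r) ℂ) (σ : ℂ) (p₀ : ℝ)
    (hE : ∀ i j, DifferentiableAt ℝ (fun p => E p i j) p₀)
    (hA : ∀ i j, DifferentiableAt ℝ (fun p => A p i j) p₀)
    (hB : ∀ i, DifferentiableAt ℝ (fun p => B p i) p₀)
    (hC : ∀ i, DifferentiableAt ℝ (fun p => C p i) p₀)
    (hfull : IsUnit (σ • E p₀ - A p₀))
    (hred : IsUnit (σ • (Wᵀ * E p₀ * V) - Wᵀ * A p₀ * V))
    (hV : ∃ z : Fin r → ℂ, (σ • E p₀ - A p₀)⁻¹ *ᵥ B p₀ = V *ᵥ z)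
    (hW : ∃ z : Fin r → ℂ, ((σ • E p₀ - A p₀)⁻¹)ᵀ *ᵥ C p₀ = W *ᵥ z) :
    DifferentiableAt ℝ (fun p : ℝ => C p ⬝ᵥ ((σ • E p - A p)⁻¹ *ᵥ B p)) p₀ ∧
    DifferentiableAt ℝ (fun p : ℝ =>
      (Vᵀ *ᵥ C p) ⬝ᵥ ((σ • (Wᵀ * E p * V) - Wᵀ * A p * V)⁻¹ *ᵥ (Wᵀ *ᵥ B p))) p₀ ∧
    deriv (fun p : ℝ => C p ⬝ᵥ ((σ • E p - A p)⁻¹ *ᵥ B p)) p₀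
      = deriv (fun p : ℝ =>
          (Vᵀ *ᵥ C p) ⬝ᵥ
            ((σ • (Wᵀ * E p * V) - Wᵀ * A p * V)⁻¹ *ᵥ (Wᵀ *ᵥ B p))) p₀ := by
  obtain ⟨z, hz⟩ := hV
  obtain ⟨w, hw⟩ := hW
  have hud := (Matrix.isUnit_iff_isUnit_det _).1 hfull
  have hx : (σ • E p₀ - A p₀) *ᵥ (V *ᵥ z) = B p₀ := by
    rw [← hz, Matrix.mulVec_mulVec, Matrix.mul_nonsing_inv _ hud, Matrix.one_mulVec]
  have hy : (W *ᵥ w) ᵥ* (σ • E p₀ - A p₀) = C p₀ := by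
    rw [← hw, Matrix.mulVec_transpose, Matrix.vecMul_vecMul, Matrix.nonsing_inv_mul _ hud,
      Matrix.vecMul_one]
  have key : ∀ p, σ • (Wᵀ * E p * V) - Wᵀ * A p * V = Wᵀ * (σ • E p - A p) * V := by
    intro p
    simp [Matrix.mul_sub, Matrix.sub_mul]
  simp only [key] at hred ⊢
  have hK : ∀ i j, DifferentiableAt ℝ (fun p => (σ • E p - A p) i j) p₀ := by
    intro i j
    simp only [Matrix.sub_apply, Matrix.smul_apply, smul_eq_mul]
    fun_prop
  generalize hKdef : (fun p => σ • E p - A p) = K at *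
  have hKp : ∀ p, σ • E p - A p = K p := fun p => by rw [← hKdef]
  simp only [hKp] at *
  obtain ⟨-, h1⟩ := aux_main K B C p₀ hK hB hC hfull _ _ hx hy
  obtain ⟨-, h2⟩ := aux_main (fun p => Wᵀ * K p * V) (fun p => Wᵀ *ᵥ B p) (fun p => Vᵀ *ᵥ C p) p₀
    (by
      intro i j
      simp only [Matrix.mul_apply]
      fun_prop)
    (by
      intro i
      simp only [Matrix.mulVec, dotProduct]
      fun_prop)
    (by
      intro i
      simp only [Matrix.mulVec, dotProduct]
      fun_prop) hred z w
    (by rw [← hx]; simp only [Matrix.mulVec_mulVec, Matrix.mul_assoc])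
    (by
      rw [← hy, Matrix.mulVec_transpose, ← Matrix.vecMul_transpose]
      simp only [Matrix.vecMul_vecMul, Matrix.mul_assoc])
  refine ⟨h1.differentiableAt, h2.differentiableAt, ?_⟩
  rw [h1.deriv, h2.deriv]
  congr 1
  funext p
  have t1 : (Vᵀ *ᵥ C p) ⬝ᵥ z = C p ⬝ᵥ (V *ᵥ z) := by
    rw [Matrix.mulVec_transpose, ← Matrix.dotProduct_mulVec]
  have t2 : ∀ v, w ⬝ᵥ (Wᵀ *ᵥ v) = (W *ᵥ w) ⬝ᵥ v := by
    intro v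
    rw [Matrix.dotProduct_mulVec, Matrix.vecMul_transpose]
  rw [t1, t2, ← Matrix.mulVec_mulVec, ← Matrix.mulVec_mulVec, t2]
end

section
/- Let σ ∈ ℂ be such that σE − A and σÊ − Â are invertible. Suppose Φ(σ)B and Φ(σ)NΦ(σ)B lie in the range of V, and Φ(σ)ᵀC lies in the range of W. Then the derivative of the bilinear transfer function with respect to its second frequency argument is matched: the derivative of s ↦ F_N(σ, s) = Cᵀ Φ(s) N Φ(σ) B at s = σ equals the derivative of s ↦ F̂_N(σ, s) = Ĉᵀ Φ̂(s) N̂ Φ̂(σ) B̂ at s = σ (both scalar functions being differentiable at σ, since invertibility holds on a neighborhood of σ). -/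
open Matrix

section Aux
attribute [local instance] Matrix.linftyOpNormedRing Matrix.linftyOpNormedAlgebra

lemma aux_hasDerivAt {m : ℕ} (E A : Matrix (Fin m) (Fin m) ℂ) (b c : Fin m → ℂ) (σ : ℂ)
    (h : IsUnit (σ • E - A)) :
    HasDerivAt (fun s : ℂ => c ⬝ᵥ ((s • E - A)⁻¹ *ᵥ b))
      (-(c ⬝ᵥ ((σ • E - A)⁻¹ *ᵥ (E *ᵥ ((σ • E - A)⁻¹ *ᵥ b))))) σ := by
  obtain ⟨u, hu⟩ := h
  have h1 : HasDerivAt (fun s : ℂ => s • E - A) E σ := by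
    have h0 := ((hasDerivAt_id σ).smul_const E).sub_const A
    rw [one_smul] at h0
    exact h0
  have h2 := hasFDerivAt_ringInverse (𝕜 := ℂ) u
  rw [hu] at h2
  have h3 := h2.comp_hasDerivAt σ h1
  let L : Matrix (Fin m) (Fin m) ℂ →ₗ[ℂ] ℂ :=
    { toFun := fun X => c ⬝ᵥ (X *ᵥ b)
      map_add' := by intro X Y; simp [Matrix.add_mulVec]
      map_smul' := by intro a X; simp [Matrix.smul_mulVec] }
  have h4 := (LinearMap.toContinuousLinearMap L).hasFDerivAt.comp_hasDerivAt σ h3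
  have hinv : ((u⁻¹ : (Matrix (Fin m) (Fin m) ℂ)ˣ) : Matrix (Fin m) (Fin m) ℂ)
      = (σ • E - A)⁻¹ := by
    rw [← hu, Matrix.coe_units_inv]
  have f1 : (fun s : ℂ => c ⬝ᵥ ((s • E - A)⁻¹ *ᵥ b))
      = (LinearMap.toContinuousLinearMap L) ∘ Ring.inverse ∘ fun s : ℂ => s • E - A := by
    funext s
    simp [L, Matrix.nonsing_inv_eq_ringInverse]
  have f2 : -(c ⬝ᵥ ((σ • E - A)⁻¹ *ᵥ (E *ᵥ ((σ • E - A)⁻¹ *ᵥ b))))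
      = (LinearMap.toContinuousLinearMap L)
      ((-((ContinuousLinearMap.mulLeftRight ℂ (Matrix (Fin m) (Fin m) ℂ)) ↑u⁻¹) ↑u⁻¹) E) := by
    rw [hinv]
    simp [L, Matrix.neg_mulVec, Matrix.mulVec_mulVec, Matrix.mul_assoc]
  rw [f1, f2]
  exact h4

end Aux

lemma aux_solve {m : ℕ} {M : Matrix (Fin m) (Fin m) ℂ} (h : IsUnit M) {x y : Fin m → ℂ}
    (hxy : M *ᵥ x = y) : M⁻¹ *ᵥ y = x := by
  rw [← hxy, Matrix.mulVec_mulVec, Matrix.nonsing_inv_mul _ ((Matrix.isUnit_iff_isUnit_det _).1 h),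
    Matrix.one_mulVec]

lemma aux_solve' {m : ℕ} {M : Matrix (Fin m) (Fin m) ℂ} (h : IsUnit M) {x y : Fin m → ℂ}
    (hxy : M⁻¹ *ᵥ y = x) : M *ᵥ x = y := by
  rw [← hxy, Matrix.mulVec_mulVec, Matrix.mul_nonsing_inv _ ((Matrix.isUnit_iff_isUnit_det _).1 h),
    Matrix.one_mulVec]

/-- Matching the derivative of the bilinear transfer function in its second
frequency argument: if `Φ(σ)B` and `Φ(σ)NΦ(σ)B` lie in the range of `V`, and
`Φ(σ)ᵀC` lies in the range of `W`, then `s ↦ F_N(σ, s)` and `s ↦ F̂_N(σ, s)`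
are differentiable at `σ` with equal derivatives. -/
theorem stmt_19 {n r : ℕ}
    (E A N : Matrix (Fin n) (Fin n) ℂ) (B C : Fin n → ℂ)
    (V W : Matrix (Fin n) (Fin r) ℂ) (σ : ℂ)
    (hfull : IsUnit (σ • E - A))
    (hred : IsUnit (σ • (Wᵀ * E * V) - Wᵀ * A * V))
    (hV1 : ∃ z : Fin r → ℂ, (σ • E - A)⁻¹ *ᵥ B = V *ᵥ z)
    (hV2 : ∃ z : Fin r → ℂ,
      (σ • E - A)⁻¹ *ᵥ (N *ᵥ ((σ • E - A)⁻¹ *ᵥ B)) = V *ᵥ z)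
    (hW : ∃ z : Fin r → ℂ, ((σ • E - A)⁻¹)ᵀ *ᵥ C = W *ᵥ z) :
    DifferentiableAt ℂ
      (fun s : ℂ => C ⬝ᵥ ((s • E - A)⁻¹ *ᵥ (N *ᵥ ((σ • E - A)⁻¹ *ᵥ B)))) σ ∧
    DifferentiableAt ℂ
      (fun s : ℂ => (Vᵀ *ᵥ C) ⬝ᵥ ((s • (Wᵀ * E * V) - Wᵀ * A * V)⁻¹ *ᵥ
        ((Wᵀ * N * V) *ᵥ ((σ • (Wᵀ * E * V) - Wᵀ * A * V)⁻¹ *ᵥ (Wᵀ *ᵥ B))))) σ ∧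
    deriv (fun s : ℂ =>
        C ⬝ᵥ ((s • E - A)⁻¹ *ᵥ (N *ᵥ ((σ • E - A)⁻¹ *ᵥ B)))) σ
      = deriv (fun s : ℂ =>
          (Vᵀ *ᵥ C) ⬝ᵥ ((s • (Wᵀ * E * V) - Wᵀ * A * V)⁻¹ *ᵥ
            ((Wᵀ * N * V) *ᵥ ((σ • (Wᵀ * E * V) - Wᵀ * A * V)⁻¹ *ᵥ (Wᵀ *ᵥ B))))) σ := by
  have d1 := aux_hasDerivAt E A (N *ᵥ ((σ • E - A)⁻¹ *ᵥ B)) C σ hfull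
  have d2 := aux_hasDerivAt (Wᵀ * E * V) (Wᵀ * A * V)
    ((Wᵀ * N * V) *ᵥ ((σ • (Wᵀ * E * V) - Wᵀ * A * V)⁻¹ *ᵥ (Wᵀ *ᵥ B))) (Vᵀ *ᵥ C) σ hred
  refine ⟨d1.differentiableAt, d2.differentiableAt, ?_⟩
  rw [d1.deriv, d2.deriv]
  obtain ⟨z1, hz1⟩ := hV1
  obtain ⟨z2, hz2⟩ := hV2
  obtain ⟨w, hw⟩ := hW
  have hM : σ • (Wᵀ * E * V) - Wᵀ * A * V = Wᵀ * (σ • E - A) * V := by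
    simp [Matrix.mul_sub, Matrix.sub_mul]
  rw [hM] at hred ⊢
  generalize σ • E - A = M at *
  have e1 : (Wᵀ * M * V)⁻¹ *ᵥ (Wᵀ *ᵥ B) = z1 := by
    apply aux_solve hred
    rw [← Matrix.mulVec_mulVec, ← Matrix.mulVec_mulVec, aux_solve' hfull hz1]
  have e2 : (Wᵀ * M * V)⁻¹ *ᵥ ((Wᵀ * N * V) *ᵥ z1) = z2 := by
    apply aux_solve hred
    rw [← Matrix.mulVec_mulVec, ← Matrix.mulVec_mulVec, aux_solve' hfull hz2, hz1,
      ← Matrix.mulVec_mulVec, ← Matrix.mulVec_mulVec]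
  have hredT : IsUnit (Wᵀ * M * V)ᵀ := (Matrix.isUnit_transpose _).2 hred
  have hfullT : IsUnit Mᵀ := (Matrix.isUnit_transpose _).2 hfull
  have e3 : ((Wᵀ * M * V)⁻¹)ᵀ *ᵥ (Vᵀ *ᵥ C) = w := by
    rw [Matrix.transpose_nonsing_inv]
    apply aux_solve hredT
    rw [Matrix.transpose_nonsing_inv] at hw
    rw [Matrix.transpose_mul, Matrix.transpose_mul, Matrix.transpose_transpose,
      ← Matrix.mulVec_mulVec, ← Matrix.mulVec_mulVec, aux_solve' hfullT hw]
  rw [e1, e2, hz2, Matrix.dotProduct_mulVec, ← Matrix.mulVec_transpose, hw,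
    Matrix.dotProduct_mulVec (Vᵀ *ᵥ C), ← Matrix.mulVec_transpose _ (Vᵀ *ᵥ C), e3,
    ← Matrix.mulVec_mulVec, ← Matrix.mulVec_mulVec, Matrix.dotProduct_mulVec w Wᵀ,
    Matrix.vecMul_transpose]
end
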